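/- Let n ≥ 1 and q ≥ 1 be integers and let Y ∼ QP(n,q). Then for every set α ⊆ E(K_n) of unordered pairs, |E[∏_{e ∈ α} Y_e]| ≤ (2·q^{−3/4})^{|V(α)|}, where V(α) is the set of vertices incident to at least one pair of α. -/

import Mathlib

open Finset

/-- Unordered pairs of distinct elements of `Fin n`, encoded as ordered pairs `(i,j)` with `i < j`. -/
abbrev Edge (n : ℕ) := {p : Fin n × Fin n // p.1 < p.2}

/-- Sample space for the quiet planting distribution `QP(n,q)`: a uniformly random
label `(a_u, b_u) ∈ [q] × [q]` for each vertex, together with independent uniform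
Rademacher variables, one for each edge. -/
abbrev QPSpace (n q : ℕ) := (Fin n → Fin q × Fin q) × (Edge n → Bool)

/-- The observed sign vector `Y ∈ {-1,+1}^{E(K_n)}` of `QP(n,q)`:
`Y_{uv} = −1` if `a_u = a_v`; `Y_{uv} = +1` if `a_u ≠ a_v` and `b_u = b_v`;
otherwise an independent uniform sign. -/
def qpY {n q : ℕ} (ω : QPSpace n q) (e : Edge n) : ℝ :=
  if (ω.1 e.val.1).1 = (ω.1 e.val.2).1 then -1
  else if (ω.1 e.val.1).2 = (ω.1 e.val.2).2 then 1
  else if ω.2 e then 1 else -1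

/-- Expectation of `f(Y)` for `Y ∼ QP(n,q)` (the sample space is uniform). -/
noncomputable def qpExp (n q : ℕ) (f : (Edge n → ℝ) → ℝ) : ℝ :=
  (∑ ω : QPSpace n q, f (fun e => qpY ω e)) / (Fintype.card (QPSpace n q) : ℝ)

/-- `V(α)`: the set of vertices incident to at least one pair of `α`. -/
def vertexSet {n : ℕ} (α : Finset (Edge n)) : Finset (Fin n) :=
  α.biUnion (fun e => {e.val.1, e.val.2})

noncomputable section QPAux

/-- Kronecker delta. -/
def dl {q : ℕ} (a b : Fin q) : ℝ := if a = b then 1 else 0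

/-- Edge factor after integrating the independent signs. -/
def ff {q : ℕ} (l m : Fin q × Fin q) : ℝ :=
  if l.1 = m.1 then -1 else if l.2 = m.2 then 1 else 0

/-- Compatibility indicator. -/
def cc {q : ℕ} (l m : Fin q × Fin q) : ℝ :=
  if l.1 = m.1 ∨ l.2 = m.2 then 1 else 0

/-- Sum over labelings of the product of edge weights. -/
def SS {n q : ℕ} (g : Fin q × Fin q → Fin q × Fin q → ℝ) (α : Finset (Edge n)) : ℝ :=
  ∑ x : Fin n → Fin q × Fin q, ∏ e ∈ α, g (x e.val.1) (x e.val.2)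

/-- Number of labelings. -/
def MM (n q : ℕ) : ℝ := (Fintype.card (Fin n → Fin q × Fin q) : ℝ)

lemma MM_pos {n q : ℕ} (hq : 1 ≤ q) : 0 < MM n q := by
  unfold MM
  have : Nonempty (Fin q) := ⟨⟨0, hq⟩⟩
  exact_mod_cast Fintype.card_pos

lemma ff_eq {q : ℕ} (l m : Fin q × Fin q) :
    ff l m = dl l.2 m.2 - dl l.1 m.1 - dl l.1 m.1 * dl l.2 m.2 := by
  unfold ff dl; split_ifs <;> norm_num

lemma ff_symm {q : ℕ} (l m : Fin q × Fin q) : ff l m = ff m l := by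
  unfold ff; simp only [eq_comm]

lemma cc_symm {q : ℕ} (l m : Fin q × Fin q) : cc l m = cc m l := by
  unfold cc; simp only [eq_comm]

lemma abs_ff_le {q : ℕ} (l m : Fin q × Fin q) : |ff l m| ≤ cc l m := by
  unfold ff cc; split_ifs <;> simp_all

lemma cc_nonneg {q : ℕ} (l m : Fin q × Fin q) : 0 ≤ cc l m := by
  unfold cc; split_ifs <;> norm_num

lemma cc_le_one {q : ℕ} (l m : Fin q × Fin q) : cc l m ≤ 1 := by
  unfold cc; split_ifs <;> norm_num

lemma cc_le {q : ℕ} (l m : Fin q × Fin q) : cc l m ≤ dl l.1 m.1 + dl l.2 m.2 := by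
  unfold cc dl; split_ifs <;> simp_all

lemma sum_dl {q : ℕ} (b : Fin q) : ∑ a, dl a b = 1 := by
  simp [dl]

lemma sum_dl_dl {q : ℕ} (b c : Fin q) : ∑ a, dl a b * dl a c = dl b c := by
  simp [dl, eq_comm]

lemma K2 {q : ℕ} (b c : Fin q) (c0 c1 c2 c3 : ℝ) :
    ∑ a, (c0 + c1 * dl a b + c2 * dl a c + c3 * (dl a b * dl a c))
      = q * c0 + c1 + c2 + c3 * dl b c := by
  simp only [sum_add_distrib, ← mul_sum, sum_dl, sum_dl_dl]
  simp

lemma sum_cc_le {q : ℕ} (m : Fin q × Fin q) : ∑ l, cc l m ≤ 2 * q := by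
  calc ∑ l, cc l m ≤ ∑ l : Fin q × Fin q, (dl l.1 m.1 + dl l.2 m.2) :=
        sum_le_sum fun l _ => cc_le l m
    _ = 2 * q := by
        rw [Fintype.sum_prod_type]
        simp only [sum_add_distrib, sum_dl]
        simp only [sum_const, card_univ, Fintype.card_fin, nsmul_eq_mul, ← mul_sum, sum_dl]
        ring

lemma sum_ff {q : ℕ} (m : Fin q × Fin q) : ∑ l, ff l m = -1 := by
  rw [Fintype.sum_prod_type]
  have h1 : ∀ a, ∑ b, ff (a, b) m = 1 + (-(q:ℝ) - 1) * dl a m.1 + 0 * dl a m.1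
      + 0 * (dl a m.1 * dl a m.1) := by
    intro a
    have := K2 m.2 m.2 (-dl a m.1) (1 - dl a m.1) 0 0
    calc _ = _ := sum_congr rfl fun b _ => ?_
      _ = _ := this
      _ = _ := by ring
    rw [ff_eq]; ring
  rw [sum_congr rfl fun a _ => h1 a, K2]
  ring

/-- Two-step kernel. -/
def hh {q : ℕ} (m p : Fin q × Fin q) : ℝ :=
  q * dl m.2 p.2 - 2 * dl m.2 p.2 - 2 + (dl m.2 p.2 + 2 + q) * dl m.1 p.1

lemma sum_ff_ff {q : ℕ} (m p : Fin q × Fin q) : ∑ l, ff l m * ff l p = hh m p := by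
  rw [Fintype.sum_prod_type]
  have h1 : ∀ a, ∑ b, ff (a, b) m * ff (a, b) p = dl m.2 p.2 + (-dl m.2 p.2 - 1) * dl a m.1
      + (-dl m.2 p.2 - 1) * dl a p.1
      + (dl m.2 p.2 + 2 + q) * (dl a m.1 * dl a p.1) := by
    intro a
    have := K2 m.2 p.2 (dl a m.1 * dl a p.1) (-(1 - dl a m.1) * dl a p.1)
      (-(1 - dl a p.1) * dl a m.1) ((1 - dl a m.1) * (1 - dl a p.1))
    calc _ = _ := sum_congr rfl fun b _ => ?_
      _ = _ := this
      _ = _ := by ring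
    rw [ff_eq, ff_eq]; ring
  rw [sum_congr rfl fun a _ => h1 a, K2]
  unfold hh
  ring

lemma sum_ff_hh {q : ℕ} (p : Fin q × Fin q) : ∑ m, hh m p * ff m p = 5 - 6 * q := by
  rw [Fintype.sum_prod_type]
  have h0 : ∀ m : Fin q × Fin q, hh m p * ff m p = ((q:ℝ) - 4) * dl m.2 p.2 - q * dl m.1 p.1
      + (5 - 2 * q) * (dl m.1 p.1 * dl m.2 p.2) := by
    intro m
    rw [ff_eq]; unfold hh dl
    split_ifs <;> ring
  have h1 : ∀ a, ∑ b, hh (a, b) p * ff (a, b) p = ((q:ℝ) - 4) + (-(q:ℝ) * q + (5 - 2 * q)) * dl a p.1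
      + 0 * dl a p.1 + 0 * (dl a p.1 * dl a p.1) := by
    intro a
    have := K2 p.2 p.2 (-(q:ℝ) * dl a p.1) ((q:ℝ) - 4 + (5 - 2 * q) * dl a p.1) 0 0
    calc _ = _ := sum_congr rfl fun b _ => ?_
      _ = _ := this
      _ = _ := by ring
    rw [h0]; ring
  rw [sum_congr rfl fun a _ => h1 a, K2]
  ring

/-- Marginalization over one coordinate. -/
lemma marg {n : ℕ} {L : Type*} [Fintype L] (u : Fin n) (G : (Fin n → L) → ℝ) :
    ∑ x : Fin n → L, ∑ l : L, G (Function.update x u l) =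
      (Fintype.card L : ℝ) * ∑ x, G x := by
  have hinv : Function.Involutive
      (fun p : (Fin n → L) × L => (Function.update p.1 u p.2, p.1 u)) := by
    rintro ⟨x, l⟩
    simp
  rw [← Fintype.sum_prod_type' (f := fun x l => G (Function.update x u l))]
  have := Equiv.sum_comp hinv.toPerm (fun p : (Fin n → L) × L => G p.1)
  simp only [Function.Involutive.coe_toPerm] at this
  rw [this, Fintype.sum_prod_type]
  simp [mul_sum]

/-- Factorization over disjoint coordinate sets. -/
lemma factor {n : ℕ} {L : Type*} [Fintype L] (T : Finset (Fin n)) (F G : (Fin n → L) → ℝ)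
    (hF : ∀ x y, F (T.piecewise x y) = F x) (hG : ∀ x y, G (T.piecewise x y) = G y) :
    (Fintype.card (Fin n → L) : ℝ) * ∑ x, F x * G x = (∑ x, F x) * ∑ x, G x := by
  have hinv : Function.Involutive
      (fun p : (Fin n → L) × (Fin n → L) => (T.piecewise p.1 p.2, T.piecewise p.2 p.1)) := by
    rintro ⟨x, y⟩
    ext i <;> by_cases hi : i ∈ T <;> simp [hi]
  have := Equiv.sum_comp hinv.toPerm (fun p : (Fin n → L) × (Fin n → L) => F p.1 * G p.1)
  simp only [Function.Involutive.coe_toPerm, hF, hG] at this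
  rw [sum_mul_sum, ← Fintype.sum_prod_type' (f := fun x y => F x * G y), this,
    Fintype.sum_prod_type]
  simp [mul_sum]

lemma prod_indep {n q : ℕ} (g : Fin q × Fin q → Fin q × Fin q → ℝ) (α : Finset (Edge n))
    (u : Fin n) (hu : ∀ e ∈ α, e.val.1 ≠ u ∧ e.val.2 ≠ u) (x : Fin n → Fin q × Fin q)
    (l : Fin q × Fin q) :
    ∏ e ∈ α, g (Function.update x u l e.val.1) (Function.update x u l e.val.2)
      = ∏ e ∈ α, g (x e.val.1) (x e.val.2) := by
  refine prod_congr rfl fun e he => ?_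
  rw [Function.update_of_ne (hu e he).1, Function.update_of_ne (hu e he).2]

/-- A leaf contributes a constant. -/
lemma leaf_ff {n q : ℕ} (u w : Fin n) (huw : w ≠ u) (F : (Fin n → Fin q × Fin q) → ℝ)
    (hF : ∀ x l, F (Function.update x u l) = F x) :
    (q : ℝ) ^ 2 * ∑ x, F x * ff (x u) (x w) = - ∑ x, F x := by
  have := marg u (fun x : Fin n → Fin q × Fin q => F x * ff (x u) (x w))
  simp only [hF, Function.update_self, Function.update_of_ne huw, ← mul_sum, sum_ff,
    Fintype.card_prod, Fintype.card_fin] at this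
  push_cast at this
  rw [sq, ← this]
  simp

lemma leaf_cc {n q : ℕ} (hq : 1 ≤ q) (u w : Fin n) (huw : w ≠ u)
    (F : (Fin n → Fin q × Fin q) → ℝ)
    (hF : ∀ x l, F (Function.update x u l) = F x) (hF0 : ∀ x, 0 ≤ F x) :
    ∑ x, F x * cc (x u) (x w) ≤ (2 / q) * ∑ x, F x := by
  have := marg u (fun x : Fin n → Fin q × Fin q => F x * cc (x u) (x w))
  simp only [hF, Function.update_self, Function.update_of_ne huw, ← mul_sum,
    Fintype.card_prod, Fintype.card_fin] at this
  push_cast at this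
  have hq' : (0:ℝ) < q := by exact_mod_cast hq
  have h2 : ∑ x : Fin n → Fin q × Fin q, F x * ∑ l, cc l (x w) ≤ (∑ x, F x) * (2 * q) := by
    rw [sum_mul]
    exact sum_le_sum fun x _ => mul_le_mul_of_nonneg_left (sum_cc_le _) (hF0 x)
  rw [this] at h2
  rw [div_mul_eq_mul_div, le_div_iff₀ hq']
  have h3 : (q:ℝ) * ((∑ x, F x * cc (x u) (x w)) * q) ≤ q * (2 * ∑ x, F x) := by
    calc _ = _ := by ring
      _ ≤ _ := h2
      _ = _ := by ring
  exact le_of_mul_le_mul_left h3 hq'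

lemma triangle {n q : ℕ} (i j k : Fin n) (hij : i ≠ j) (hik : i ≠ k) (hjk : j ≠ k) :
    (q : ℝ) ^ 4 * ∑ x : Fin n → Fin q × Fin q, ff (x i) (x j) * ff (x i) (x k) * ff (x j) (x k)
      = (5 - 6 * q) * MM n q := by
  have h1 := marg i (fun x : Fin n → Fin q × Fin q =>
    ff (x i) (x j) * ff (x i) (x k) * ff (x j) (x k))
  simp only [Function.update_self, Function.update_of_ne hij.symm, Function.update_of_ne hik.symm,
    ← sum_mul, sum_ff_ff, Fintype.card_prod, Fintype.card_fin] at h1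
  have h2 := marg j (fun x : Fin n → Fin q × Fin q => hh (x j) (x k) * ff (x j) (x k))
  simp only [Function.update_self, Function.update_of_ne hjk.symm, sum_ff_hh,
    Fintype.card_prod, Fintype.card_fin] at h2
  push_cast at h1 h2
  rw [h1] at h2
  unfold MM
  rw [sum_const, nsmul_eq_mul, card_univ] at h2
  linarith

lemma abs_SS_le {n q : ℕ} (α : Finset (Edge n)) :
    |SS (q := q) ff α| ≤ SS (q := q) cc α := by
  unfold SS
  refine (abs_sum_le_sum_abs _ _).trans (sum_le_sum fun x _ => ?_)
  rw [abs_prod]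
  exact prod_le_prod (fun _ _ => abs_nonneg _) fun _ _ => abs_ff_le _ _

lemma SS_cc_anti {n q : ℕ} {α β : Finset (Edge n)} (h : α ⊆ β) :
    SS (q := q) cc β ≤ SS (q := q) cc α := by
  unfold SS
  refine sum_le_sum fun x _ => ?_
  rw [← prod_sdiff h]
  exact mul_le_of_le_one_left (prod_nonneg fun _ _ => cc_nonneg _ _)
    (prod_le_one (fun _ _ => cc_nonneg _ _) fun _ _ => cc_le_one _ _)

/-- Edges inside `T`. -/
def ins {n : ℕ} (α : Finset (Edge n)) (T : Finset (Fin n)) : Finset (Edge n) :=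
  α.filter fun e => e.val.1 ∈ T ∧ e.val.2 ∈ T

lemma grow {n q : ℕ} (hq : 1 ≤ q) (α : Finset (Edge n)) (T : Finset (Fin n)) (e : Edge n)
    (he : e ∈ α) (u w : Fin n) (hu : u ∉ T) (hw : w ∈ T)
    (hor : (e.val.1 = u ∧ e.val.2 = w) ∨ (e.val.1 = w ∧ e.val.2 = u)) :
    SS (q := q) cc (ins α (insert u T)) ≤ (2 / q) * SS (q := q) cc (ins α T) := by
  have huw : w ≠ u := fun h => hu (h ▸ hw)
  have hnot : e ∉ ins α T := by
    intro h
    have := (mem_filter.1 h).2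
    rcases hor with h | h <;> simp_all
  have hsub : insert e (ins α T) ⊆ ins α (insert u T) := by
    intro e' he'
    rcases mem_insert.1 he' with rfl | h
    · refine mem_filter.2 ⟨he, ?_⟩
      rcases hor with h | h <;> simp [h.1, h.2, hw]
    · have := mem_filter.1 h
      exact mem_filter.2 ⟨this.1, mem_insert_of_mem this.2.1, mem_insert_of_mem this.2.2⟩
  refine (SS_cc_anti hsub).trans ?_
  have key := leaf_cc hq u w huw
    (fun x : Fin n → Fin q × Fin q => ∏ e ∈ ins α T, cc (x e.val.1) (x e.val.2))
    (fun x l => prod_indep cc _ u (fun e' he' => by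
      have := (mem_filter.1 he').2
      exact ⟨fun h => hu (h ▸ this.1), fun h => hu (h ▸ this.2)⟩) x l)
    (fun x => prod_nonneg fun _ _ => cc_nonneg _ _)
  refine le_trans (le_of_eq ?_) key
  unfold SS
  refine sum_congr rfl fun x _ => ?_
  rw [prod_insert hnot, mul_comm]
  congr 1
  rcases hor with h | h
  · rw [h.1, h.2]
  · rw [h.1, h.2, cc_symm]

lemma mem_vs {n : ℕ} {α : Finset (Edge n)} {v : Fin n} :
    v ∈ vertexSet α ↔ ∃ e ∈ α, v = e.val.1 ∨ v = e.val.2 := by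
  simp [vertexSet]

/-- A closed set obtained by growing. -/
lemma exists_closed {n q : ℕ} (hq : 1 ≤ q) (α : Finset (Edge n)) (v : Fin n)
    (hv : v ∈ vertexSet α) :
    ∃ T : Finset (Fin n), v ∈ T ∧ T ⊆ vertexSet α ∧
      (∀ e ∈ α, e.val.1 ∈ T ↔ e.val.2 ∈ T) ∧
      SS (q := q) cc (ins α T) ≤ (2 / q) ^ (T.card - 1) * MM n q := by
  classical
  let P : Finset (Finset (Fin n)) := univ.filter fun T => v ∈ T ∧ T ⊆ vertexSet α ∧
      SS (q := q) cc (ins α T) ≤ (2 / q) ^ (T.card - 1) * MM n q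
  have hne : P.Nonempty := by
    refine ⟨{v}, mem_filter.2 ⟨mem_univ _, by simp, by simpa using hv, ?_⟩⟩
    have : ins α {v} = ∅ := by
      unfold ins
      refine filter_eq_empty_iff.2 fun e _ h => ?_
      have h1 := mem_singleton.1 h.1
      have h2 := mem_singleton.1 h.2
      have := e.2
      rw [h1, h2] at this
      exact lt_irrefl _ this
    rw [this]
    simp [SS, MM]
  obtain ⟨T, hT, hmax⟩ := exists_max_image P card hne
  obtain ⟨-, hvT, hTs, hb⟩ := mem_filter.1 hT
  refine ⟨T, hvT, hTs, ?_, hb⟩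
  have step : ∀ e ∈ α, ∀ u w, u ∉ T → w ∈ T →
      ((e.val.1 = u ∧ e.val.2 = w) ∨ (e.val.1 = w ∧ e.val.2 = u)) → False := by
    intro e he u w hu hw hor
    have hg := grow hq α T e he u w hu hw hor
    have hmem : insert u T ∈ P := by
      refine mem_filter.2 ⟨mem_univ _, mem_insert_of_mem hvT, ?_, ?_⟩
      · refine insert_subset (mem_vs.2 ⟨e, he, ?_⟩) hTs
        rcases hor with h | h
        · exact Or.inl h.1.symm
        · exact Or.inr h.2.symm
      · refine hg.trans ?_
        rw [card_insert_of_notMem hu]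
        have hpos : 1 ≤ T.card := card_pos.2 ⟨v, hvT⟩
        have : T.card + 1 - 1 = (T.card - 1) + 1 := by omega
        rw [this, pow_succ']
        rw [mul_assoc]
        exact mul_le_mul_of_nonneg_left hb (by positivity)
    have := hmax _ hmem
    rw [card_insert_of_notMem hu] at this
    omega
  intro e he
  constructor
  · intro h
    by_contra h'
    exact step e he _ _ h' h (Or.inr ⟨rfl, rfl⟩)
  · intro h
    by_contra h'
    exact step e he _ _ h' h (Or.inl ⟨rfl, rfl⟩)

lemma real_bound {q : ℕ} (hq : 1 ≤ q) (k m : ℕ) (c : ℝ) (hc : c ≤ 2 ^ k)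
    (hm : 3 * k ≤ 4 * m) :
    c / (q : ℝ) ^ m ≤ (2 * (q : ℝ) ^ (-(3 : ℝ) / 4)) ^ k := by
  have hq1 : (1:ℝ) ≤ q := by exact_mod_cast hq
  have hq' : (0:ℝ) < q := by linarith
  rw [mul_pow, div_eq_mul_inv]
  have h1 : ((q:ℝ) ^ m)⁻¹ ≤ ((q : ℝ) ^ (-(3 : ℝ) / 4)) ^ k := by
    rw [← Real.rpow_natCast, ← Real.rpow_natCast, ← Real.rpow_mul hq'.le, ← Real.rpow_neg hq'.le]
    refine Real.rpow_le_rpow_of_exponent_le hq1 ?_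
    have : (3:ℝ) * k ≤ 4 * m := by exact_mod_cast hm
    linarith
  exact mul_le_mul hc h1 (by positivity) (by positivity)

lemma SS_empty {n q : ℕ} : SS (q := q) ff (∅ : Finset (Edge n)) = MM n q := by
  simp [SS, MM]

lemma SS_one {n q : ℕ} (e : Edge n) : (q:ℝ)^2 * SS (q := q) ff {e} = - MM n q := by
  have := leaf_ff (q := q) e.val.1 e.val.2 (ne_of_gt e.2) (fun _ => 1) (fun _ _ => rfl)
  simp only [one_mul] at this
  simp only [SS, prod_singleton]
  rw [this]
  simp [MM]

/-- Two edges forming a path with leaf `u`. -/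
lemma SS_two {n q : ℕ} (e e' : Edge n) (u w : Fin n)
    (hor : (e.val.1 = u ∧ e.val.2 = w) ∨ (e.val.1 = w ∧ e.val.2 = u))
    (h1 : e'.val.1 ≠ u) (h2 : e'.val.2 ≠ u) :
    (q:ℝ)^4 * SS (q := q) ff {e, e'} = MM n q := by
  have hee : e ≠ e' := by
    rintro rfl
    rcases hor with h | h <;> simp_all
  have huw : w ≠ u := by
    have := e.2
    rcases hor with h | h
    · rw [h.1, h.2] at this; exact this.ne'
    · rw [h.1, h.2] at this; exact this.ne
  have hleaf := leaf_ff (q := q) u w huw (fun x => ff (x e'.val.1) (x e'.val.2)) (fun x l => by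
    rw [Function.update_of_ne h1, Function.update_of_ne h2])
  have h3 := SS_one (q := q) e'
  simp only [SS, prod_singleton] at h3
  have h4 : SS (q := q) ff {e, e'} =
      ∑ x : Fin n → Fin q × Fin q, ff (x e'.val.1) (x e'.val.2) * ff (x u) (x w) := by
    unfold SS
    refine sum_congr rfl fun x _ => ?_
    rw [prod_pair hee, mul_comm]
    congr 1
    rcases hor with h | h
    · rw [h.1, h.2]
    · rw [h.1, h.2, ff_symm]
  rw [h4]
  have : (q:ℝ)^4 * ∑ x : Fin n → Fin q × Fin q, ff (x e'.val.1) (x e'.val.2) * ff (x u) (x w)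
    = q^2 * (q^2 * ∑ x : Fin n → Fin q × Fin q, ff (x e'.val.1) (x e'.val.2) * ff (x u) (x w)) := by
    ring
  rw [this, hleaf, mul_neg, h3, neg_neg]

lemma SS_div {n q : ℕ} (hq : 1 ≤ q) (m : ℕ) (S c : ℝ) (h : (q:ℝ)^m * S = c * MM n q) :
    |S / MM n q| = |c| / (q:ℝ)^m := by
  have hq' : (0:ℝ) < q := by exact_mod_cast hq
  have := MM_pos (n := n) hq
  have : S / MM n q = c / (q:ℝ)^m := by
    rw [div_eq_div_iff this.ne' (by positivity)]
    linarith
  rw [this, abs_div, abs_of_pos (a := (q:ℝ)^m) (by positivity)]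

lemma exists_sorted3 {n : ℕ} (T : Finset (Fin n)) (hT : T.card = 3) :
    ∃ i j k, i < j ∧ j < k ∧ T = {i, j, k} := by
  let f := T.orderEmbOfFin hT
  refine ⟨f 0, f 1, f 2, f.strictMono (by decide), f.strictMono (by decide), ?_⟩
  have : (univ.map f.toEmbedding) = T := by
    simp [f]
  rw [← this]
  ext a
  simp [Fin.exists_fin_succ, eq_comm]

/-- Bound for one closed block. -/
lemma block {n q : ℕ} (hq : 1 ≤ q) (β : Finset (Edge n)) (T : Finset (Fin n))
    (hin : ∀ e ∈ β, e.val.1 ∈ T ∧ e.val.2 ∈ T) (hcov : ∀ v ∈ T, v ∈ vertexSet β)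
    (hTne : T.Nonempty)
    (hb : SS (q := q) cc β ≤ (2 / q) ^ (T.card - 1) * MM n q) :
    |SS (q := q) ff β / MM n q| ≤ (2 * (q : ℝ) ^ (-(3 : ℝ) / 4)) ^ T.card := by
  have hM := MM_pos (n := n) hq
  have hq1 : (1:ℝ) ≤ q := by exact_mod_cast hq
  have hpos : 1 ≤ T.card := card_pos.2 hTne
  by_cases h4 : 4 ≤ T.card
  · rw [abs_div, abs_of_pos hM]
    calc _ ≤ (2 / (q:ℝ)) ^ (T.card - 1) := by
          rw [div_le_iff₀ hM]
          exact (abs_SS_le β).trans hb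
      _ = 2 ^ (T.card - 1) / (q:ℝ) ^ (T.card - 1) := by rw [div_pow]
      _ ≤ _ := real_bound hq _ _ _ (pow_le_pow_right₀ (by norm_num) (by omega)) (by omega)
  have hne2 : 2 ≤ T.card := by
    obtain ⟨v, hv⟩ := hTne
    obtain ⟨e, he, -⟩ := mem_vs.1 (hcov v hv)
    have h := hin e he
    exact one_lt_card.2 ⟨_, h.1, _, h.2, ne_of_lt e.2⟩
  by_cases h2 : T.card = 2
  · obtain ⟨v, hv⟩ := hTne
    obtain ⟨e, he, -⟩ := mem_vs.1 (hcov v hv)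
    have hpair : ∀ e ∈ β, ({e.val.1, e.val.2} : Finset (Fin n)) = T := by
      intro e he
      refine eq_of_subset_of_card_le ?_ ?_
      · have := hin e he
        intro a ha
        rcases mem_insert.1 ha with rfl | h
        · exact this.1
        · rw [mem_singleton.1 h]; exact this.2
      · rw [h2, card_pair (ne_of_lt e.2)]
    have hβ : β = {e} := by
      refine eq_singleton_iff_unique_mem.2 ⟨he, fun e' he' => ?_⟩
      have h := (hpair e' he').trans (hpair e he).symm
      have l1 := e.2
      have l2 := e'.2
      have m1 : e'.val.1 ∈ ({e.val.1, e.val.2} : Finset (Fin n)) := h ▸ by simp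
      have m2 : e'.val.2 ∈ ({e.val.1, e.val.2} : Finset (Fin n)) := h ▸ by simp
      simp only [mem_insert, mem_singleton] at m1 m2
      refine Subtype.ext (Prod.ext ?_ ?_) <;> omega
    rw [hβ, SS_div hq 2 _ (-1) (by rw [SS_one]; ring), h2]
    exact real_bound hq _ _ _ (by norm_num) (by norm_num)
  have h3 : T.card = 3 := by omega
  obtain ⟨i, j, k, hij, hjk, hT⟩ := exists_sorted3 T h3
  have hik := hij.trans hjk
  let a : Edge n := ⟨(i, j), hij⟩
  let b : Edge n := ⟨(i, k), hik⟩
  let c : Edge n := ⟨(j, k), hjk⟩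
  have hab : a ≠ b := fun h => hjk.ne (congrArg (fun e : Edge n => e.val.2) h)
  have hac : a ≠ c := fun h => hij.ne (congrArg (fun e : Edge n => e.val.1) h)
  have hbc : b ≠ c := fun h => hij.ne (congrArg (fun e : Edge n => e.val.1) h)
  have hsub : ∀ e ∈ β, e = a ∨ e = b ∨ e = c := by
    intro e he
    have h := hin e he
    have l := e.2
    rw [hT] at h
    simp only [mem_insert, mem_singleton] at h
    have : (e.val.1 = i ∧ e.val.2 = j) ∨ (e.val.1 = i ∧ e.val.2 = k) ∨
      (e.val.1 = j ∧ e.val.2 = k) := by omega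
    rcases this with h | h | h
    · exact Or.inl (Subtype.ext (Prod.ext h.1 h.2))
    · exact Or.inr (Or.inl (Subtype.ext (Prod.ext h.1 h.2)))
    · exact Or.inr (Or.inr (Subtype.ext (Prod.ext h.1 h.2)))
  have ci : a ∈ β ∨ b ∈ β := by
    obtain ⟨e, he, h⟩ := mem_vs.1 (hcov i (by simp [hT]))
    rcases hsub e he with rfl | rfl | rfl
    · exact Or.inl he
    · exact Or.inr he
    · exfalso; simp only [c] at h; omega
  have cj : a ∈ β ∨ c ∈ β := by
    obtain ⟨e, he, h⟩ := mem_vs.1 (hcov j (by simp [hT]))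
    rcases hsub e he with rfl | rfl | rfl
    · exact Or.inl he
    · exfalso; simp only [b] at h; omega
    · exact Or.inr he
  have ck : b ∈ β ∨ c ∈ β := by
    obtain ⟨e, he, h⟩ := mem_vs.1 (hcov k (by simp [hT]))
    rcases hsub e he with rfl | rfl | rfl
    · exfalso; simp only [a] at h; omega
    · exact Or.inl he
    · exact Or.inr he
  have fin2 : (q:ℝ)^4 * SS (q := q) ff β = MM n q →
      |SS (q := q) ff β / MM n q| ≤ (2 * (q : ℝ) ^ (-(3 : ℝ) / 4)) ^ T.card := by
    intro h
    rw [SS_div hq 4 _ 1 (by rw [h]; ring), h3]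
    exact real_bound hq _ _ _ (by norm_num) (by norm_num)
  by_cases ha : a ∈ β
  · by_cases hb' : b ∈ β
    · by_cases hc : c ∈ β
      · have hβ : β = {a, b, c} := by
          ext e
          simp only [mem_insert, mem_singleton]
          exact ⟨hsub e, by rintro (rfl | rfl | rfl) <;> assumption⟩
        have ht := triangle (q := q) i j k hij.ne hik.ne hjk.ne
        have hS : SS (q := q) ff β = ∑ x : Fin n → Fin q × Fin q,
            ff (x i) (x j) * ff (x i) (x k) * ff (x j) (x k) := by
          rw [hβ]; unfold SS
          refine sum_congr rfl fun x _ => ?_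
          rw [prod_insert (by simp [hab, hac]), prod_pair hbc, mul_assoc]
        rw [← hS] at ht
        rw [SS_div hq 4 _ _ ht, h3]
        have habs : |5 - 6 * (q:ℝ)| ≤ 6 * q := by
          rw [abs_le]; constructor <;> linarith
        calc |5 - 6 * (q:ℝ)| / (q:ℝ)^4 ≤ 6 * q / (q:ℝ)^4 := by gcongr
          _ = 6 / (q:ℝ)^3 := by field_simp
          _ ≤ _ := real_bound hq _ _ _ (by norm_num) (by norm_num)
      · apply fin2
        have hβ : β = {a, b} := by
          ext e
          simp only [mem_insert, mem_singleton]
          refine ⟨fun h => ?_, by rintro (rfl | rfl) <;> assumption⟩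
          rcases hsub e h with rfl | rfl | rfl <;> simp_all
        rw [hβ]
        exact SS_two a b j i (Or.inr ⟨rfl, rfl⟩) hij.ne hjk.ne'
    · apply fin2
      have hc : c ∈ β := by tauto
      have hβ : β = {a, c} := by
        ext e
        simp only [mem_insert, mem_singleton]
        refine ⟨fun h => ?_, by rintro (rfl | rfl) <;> assumption⟩
        rcases hsub e h with rfl | rfl | rfl <;> simp_all
      rw [hβ]
      exact SS_two a c i j (Or.inl ⟨rfl, rfl⟩) hij.ne' hik.ne'
  · apply fin2
    have hb' : b ∈ β := by tauto
    have hc : c ∈ β := by tauto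
    have hβ : β = {b, c} := by
      ext e
      simp only [mem_insert, mem_singleton]
      refine ⟨fun h => ?_, by rintro (rfl | rfl) <;> assumption⟩
      rcases hsub e h with rfl | rfl | rfl <;> simp_all
    rw [hβ]
    exact SS_two b c i k (Or.inl ⟨rfl, rfl⟩) hij.ne' hik.ne'

lemma SS_bound {n q : ℕ} (hq : 1 ≤ q) (m : ℕ) : ∀ α : Finset (Edge n), α.card ≤ m →
    |SS (q := q) ff α / MM n q| ≤ (2 * (q : ℝ) ^ (-(3 : ℝ) / 4)) ^ (vertexSet α).card := by
  have hM := MM_pos (n := n) hq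
  have hempty : |SS (q := q) ff (∅ : Finset (Edge n)) / MM n q| ≤
      (2 * (q : ℝ) ^ (-(3 : ℝ) / 4)) ^ (vertexSet (∅ : Finset (Edge n))).card := by
    rw [SS_empty, div_self hM.ne']; simp [vertexSet]
  induction m with
  | zero =>
    intro α hα
    have : α = ∅ := card_eq_zero.1 (by omega)
    subst this
    exact hempty
  | succ m ih =>
    intro α hα
    rcases α.eq_empty_or_nonempty with rfl | ⟨e0, he0⟩
    · exact hempty
    obtain ⟨T, hvT, hTs, hcl, hb⟩ := exists_closed (q := q) hq α e0.val.1
      (mem_vs.2 ⟨e0, he0, Or.inl rfl⟩)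
    let γ := α.filter fun e => ¬ (e.val.1 ∈ T ∧ e.val.2 ∈ T)
    have hγ : ∀ e ∈ γ, e.val.1 ∉ T ∧ e.val.2 ∉ T := by
      intro e he
      obtain ⟨h1, h2⟩ := mem_filter.1 he
      have := hcl e h1
      tauto
    have hins : ∀ e ∈ ins α T, e.val.1 ∈ T ∧ e.val.2 ∈ T := fun e he => (mem_filter.1 he).2
    have hcov : ∀ v ∈ T, v ∈ vertexSet (ins α T) := by
      intro v hv
      obtain ⟨e, he, h⟩ := mem_vs.1 (hTs hv)
      refine mem_vs.2 ⟨e, mem_filter.2 ⟨he, ?_⟩, h⟩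
      have := hcl e he
      rcases h with rfl | rfl <;> tauto
    have hB := block hq (ins α T) T hins hcov ⟨_, hvT⟩ hb
    have hlt : γ.card < α.card := by
      refine card_lt_card (filter_ssubset.2 ⟨e0, he0, ?_⟩)
      have := hcl e0 he0
      tauto
    have hC := ih γ (by omega)
    have hcard : (vertexSet α).card = T.card + (vertexSet γ).card := by
      rw [← card_union_of_disjoint]
      · congr 1
        ext v
        simp only [mem_union, mem_vs]
        constructor
        · rintro ⟨e, he, h⟩
          by_cases hh : e.val.1 ∈ T ∧ e.val.2 ∈ T
          · left
            rcases h with rfl | rfl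
            · exact hh.1
            · exact hh.2
          · exact Or.inr ⟨e, mem_filter.2 ⟨he, hh⟩, h⟩
        · rintro (h | ⟨e, he, h⟩)
          · exact mem_vs.1 (hTs h)
          · exact ⟨e, (mem_filter.1 he).1, h⟩
      · refine disjoint_left.2 fun v hv hv' => ?_
        obtain ⟨e, he, h⟩ := mem_vs.1 hv'
        have := hγ e he
        rcases h with rfl | rfl
        · exact this.1 hv
        · exact this.2 hv
    have hfac := factor T
      (fun x : Fin n → Fin q × Fin q => ∏ e ∈ ins α T, ff (x e.val.1) (x e.val.2))
      (fun x => ∏ e ∈ γ, ff (x e.val.1) (x e.val.2))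
      (fun x y => prod_congr rfl fun e he => by
        rw [piecewise_eq_of_mem _ _ _ (hins e he).1, piecewise_eq_of_mem _ _ _ (hins e he).2])
      (fun x y => prod_congr rfl fun e he => by
        rw [piecewise_eq_of_notMem _ _ _ (hγ e he).1, piecewise_eq_of_notMem _ _ _ (hγ e he).2])
    have hfac' : MM n q * SS (q := q) ff α = SS (q := q) ff (ins α T) * SS (q := q) ff γ := by
      refine Eq.trans ?_ hfac
      unfold MM SS
      congr 1
      refine sum_congr rfl fun x _ => ?_
      exact (prod_filter_mul_prod_filter_not α _ _).symm
    have hdiv : SS (q := q) ff α / MM n q =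
        (SS (q := q) ff (ins α T) / MM n q) * (SS (q := q) ff γ / MM n q) := by
      rw [div_mul_div_comm, ← hfac']
      field_simp
    rw [hdiv, abs_mul, hcard, pow_add]
    exact mul_le_mul hB hC (abs_nonneg _) (by positivity)

lemma qpExp_eq {n q : ℕ} (α : Finset (Edge n)) :
    qpExp n q (fun Y => ∏ e ∈ α, Y e) = SS (q := q) ff α / MM n q := by
  unfold qpExp
  have h : ∑ ω : QPSpace n q, ∏ e ∈ α, qpY ω e =
      (Fintype.card (Edge n → Bool) : ℝ) * SS (q := q) ff α := by
    rw [Fintype.sum_prod_type]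
    unfold SS
    rw [mul_sum]
    refine sum_congr rfl fun x _ => ?_
    let g : Edge n → Bool → ℝ := fun e b => if e ∈ α then
      (if (x e.val.1).1 = (x e.val.2).1 then -1
        else if (x e.val.1).2 = (x e.val.2).2 then 1
        else if b then 1 else -1) else 1
    have h1 : ∀ s : Edge n → Bool, ∏ e ∈ α, qpY (x, s) e = ∏ e, g e (s e) := by
      intro s
      simp only [g]
      rw [prod_ite_mem]
      simp [qpY]
    have h2 : ∑ s : Edge n → Bool, ∏ e, g e (s e) = ∏ e, ∑ b, g e b := by
      rw [Finset.prod_univ_sum, Fintype.piFinset_univ]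
    have h3 : ∀ e, ∑ b, g e b = 2 * (if e ∈ α then ff (x e.val.1) (x e.val.2) else 1) := by
      intro e
      simp only [g, Fintype.sum_bool, ff]
      split_ifs <;> simp_all <;> norm_num
    rw [sum_congr rfl fun s _ => h1 s, h2, prod_congr rfl fun e _ => h3 e, prod_mul_distrib,
      prod_ite_mem]
    simp
  rw [h, Fintype.card_prod]
  unfold MM
  push_cast
  rw [mul_comm]
  have : ((Fintype.card (Edge n → Bool) : ℕ) : ℝ) ≠ 0 := by
    exact_mod_cast Fintype.card_ne_zero
  exact mul_div_mul_right _ _ this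

end QPAux

/-- For `n, q ≥ 1` and `Y ∼ QP(n,q)`, every set `α` of unordered
pairs satisfies `|E[∏_{e ∈ α} Y_e]| ≤ (2·q^{−3/4})^{|V(α)|}`. -/
theorem stmt6 (n q : ℕ) (hn : 1 ≤ n) (hq : 1 ≤ q) (α : Finset (Edge n)) :
    |qpExp n q (fun Y => ∏ e ∈ α, Y e)| ≤
      (2 * (q : ℝ) ^ (-(3 : ℝ) / 4)) ^ (vertexSet α).card := by
  rw [qpExp_eq]
  exact SS_bound hq _ α le_rfl
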